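/- Dual Ramsey theorem for finite boolean algebras: for every integer k ≥ 2 and all finite boolean algebras A and B such that there exists a surjective boolean-algebra homomorphism from B onto A, there exists a finite boolean algebra C such that for every k-coloring χ of the set Surj(C, A) of all surjective boolean-algebra homomorphisms C → A satisfying χ(α ∘ f) = χ(f) for every automorphism α of A and every f ∈ Surj(C, A), there exist a color i and a surjective boolean-algebra homomorphism w : C → B such that χ(f ∘ w) = i for every f ∈ Surj(B, A). -/

import Mathlib

open Function

/-- A boolean-algebra homomorphism: a map preserving `⊔`, `⊓`, complementation,
`⊥` and `⊤`. -/
def IsBoolHom {A B : Type*} [BooleanAlgebra A] [BooleanAlgebra B] (f : A → B) : Prop :=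
  (∀ x y : A, f (x ⊔ y) = f x ⊔ f y) ∧ (∀ x y : A, f (x ⊓ y) = f x ⊓ f y) ∧
    (∀ x : A, f xᶜ = (f x)ᶜ) ∧ f ⊥ = ⊥ ∧ f ⊤ = ⊤

/-- A finite boolean algebra (bundled). -/
structure BundledFinBoolAlg where
  carrier : Type
  [ba : BooleanAlgebra carrier]
  [fin : Fintype carrier]

attribute [instance] BundledFinBoolAlg.ba BundledFinBoolAlg.fin

namespace IsBoolHom

variable {A B C : Type*} [BooleanAlgebra A] [BooleanAlgebra B] [BooleanAlgebra C]

theorem comp {g : B → C} {f : A → B} (hg : IsBoolHom g) (hf : IsBoolHom f) :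
    IsBoolHom (g ∘ f) := by
  obtain ⟨g₁, g₂, g₃, g₄, g₅⟩ := hg
  obtain ⟨f₁, f₂, f₃, f₄, f₅⟩ := hf
  refine ⟨?_, ?_, ?_, ?_, ?_⟩ <;> simp_all

theorem orderIso (e : A ≃o B) : IsBoolHom e :=
  ⟨map_sup e, map_inf e, fun x => map_compl' e x, map_bot e, map_top e⟩

theorem preimage {a c : Type*} (φ : a → c) : IsBoolHom (Set.preimage φ) :=
  ⟨fun _ _ => rfl, fun _ _ => rfl, fun _ => rfl, rfl, rfl⟩

/-- Surjective homomorphisms between finite power sets are preimages along injections. -/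
theorem exists_injective_eq_preimage {a c : Type*} [Finite c] {g : Set c → Set a}
    (hg : IsBoolHom g) (hs : Surjective g) :
    ∃ φ : a → c, Injective φ ∧ g = Set.preimage φ := by
  obtain ⟨hsup, -, hcompl, hbot, htop⟩ := hg
  have hex : ∀ x, ∃ n, x ∈ g {n} := by
    intro x
    by_contra! h
    have key : ∀ S : Set c, x ∉ g S := fun S =>
      S.toFinite.induction_on S (by
        show x ∉ g ⊥
        rw [hbot]; exact id) (by
        intro n S _ _ ih
        rw [show insert n S = {n} ⊔ S from rfl, hsup]
        rintro (h' | h')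
        exacts [h n h', ih h'])
    exact key ⊤ (htop ▸ Set.mem_univ x)
  choose φ hφ using hex
  have hmono : ∀ S T : Set c, S ⊆ T → g S ⊆ g T := by
    intro S T h
    have := hsup S T
    rw [sup_eq_right.2 h] at this
    rw [this]
    exact le_sup_left
  have hmem : ∀ S x, x ∈ g S ↔ φ x ∈ S := by
    refine fun S x => ⟨fun h => ?_, fun h => hmono _ _ (by simpa using h) (hφ x)⟩
    by_contra hn
    have := hmono {φ x} Sᶜ (by simpa using hn) (hφ x)
    rw [hcompl] at this
    exact this h
  refine ⟨φ, fun x y hxy => ?_, by ext S x; exact hmem S x⟩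
  obtain ⟨S, hS⟩ := hs {x}
  have hx : x ∈ g S := by rw [hS]; rfl
  have hy : y ∈ g S := by rwa [hmem, ← hxy, ← hmem]
  rw [hS] at hy
  exact hy.symm

end IsBoolHom

/-- A finite boolean algebra is isomorphic to the power set of a finite type. -/
theorem exists_orderIso_set (A : Type) [BooleanAlgebra A] [Finite A] :
    ∃ a : Type, Finite a ∧ Nonempty (A ≃o Set a) := by
  have := Fintype.ofFinite A
  let _ := Fintype.toCompleteAtomicBooleanAlgebra A
  exact ⟨{x : A // IsAtom x}, inferInstance, ⟨CompleteAtomicBooleanAlgebra.toSetOfIsAtom⟩⟩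

/-- The inductive step of Ramsey's theorem: from the theorem for `m`-subsets, one gets large sets
on which the color of an `(m + 1)`-subset depends only on its least element. -/
theorem exists_minHomogeneous {κ : Type} [Nonempty κ] {m : ℕ}
    (ih : ∀ n : ℕ, ∃ N : ℕ, ∀ (α : Type) [LinearOrder α] (S : Finset α) (χ : Finset α → κ),
      N ≤ S.card → ∃ T ⊆ S, T.card = n ∧ ∃ i, ∀ s ⊆ T, s.card = m → χ s = i) (n : ℕ) :
    ∃ N : ℕ, ∀ (α : Type) [LinearOrder α] (S : Finset α) (χ : Finset α → κ),
      N ≤ S.card → ∃ T ⊆ S, T.card = n ∧ ∃ c : α → κ, ∀ x ∈ T, ∀ s ⊆ T,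
        (∀ y ∈ s, x < y) → s.card = m → χ (insert x s) = c x := by
  induction n with
  | zero => exact ⟨0, fun α _ S χ _ => ⟨∅, by simp, rfl, fun _ => Classical.arbitrary κ, by simp⟩⟩
  | succ n ihn =>
    obtain ⟨N, hN⟩ := ihn
    obtain ⟨M, hM⟩ := ih N
    refine ⟨M + 1, fun α _ S χ hS => ?_⟩
    have hne : S.Nonempty := Finset.card_pos.1 (by omega)
    set x := S.min' hne
    have hxS : x ∈ S := S.min'_mem hne
    obtain ⟨U, hUS, hUc, i, hi⟩ := hM α (S.erase x) (fun s => χ (insert x s))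
      (by rw [Finset.card_erase_of_mem hxS]; omega)
    obtain ⟨T, hTU, hTc, c, hc⟩ := hN α U χ hUc.ge
    have hlt : ∀ y ∈ T, x < y := fun y hy => S.min'_lt_of_mem_erase_min' hne (hUS (hTU hy))
    have hxT : x ∉ T := fun h => (hlt x h).false
    refine ⟨insert x T, ?_, by simp [hxT, hTc], update c x i, ?_⟩
    · exact Finset.insert_subset hxS ((hTU.trans hUS).trans (Finset.erase_subset _ _))
    · intro y hy s hs hys hsc
      have hsT : s ⊆ T := by
        intro z hz
        refine (Finset.mem_insert.1 (hs hz)).resolve_left ?_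
        rintro rfl
        rcases Finset.mem_insert.1 hy with rfl | h
        exacts [(hys _ hz).false, ((hys _ hz).trans (hlt _ h)).false]
      rcases Finset.mem_insert.1 hy with rfl | h
      · rw [update_self]
        exact hi s (hsT.trans hTU) hsc
      · rw [update_of_ne (hlt y h).ne']
        exact hc y h s hsT hys hsc

/-- The finite **Ramsey theorem** for colorings of `m`-subsets. -/
theorem exists_monochromatic_subset (κ : Type) [Finite κ] [Nonempty κ] (m n : ℕ) :
    ∃ N : ℕ, ∀ (α : Type) [LinearOrder α] (S : Finset α) (χ : Finset α → κ),
      N ≤ S.card → ∃ T ⊆ S, T.card = n ∧ ∃ i, ∀ s ⊆ T, s.card = m → χ s = i := by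
  classical
  have := Fintype.ofFinite κ
  induction m generalizing n with
  | zero =>
    refine ⟨n, fun α _ S χ hS => ?_⟩
    obtain ⟨T, hTS, hT⟩ := Finset.exists_subset_card_eq hS
    exact ⟨T, hTS, hT, χ ∅, fun s _ hs => by rw [Finset.card_eq_zero.1 hs]⟩
  | succ m ih =>
    obtain ⟨N, hN⟩ := exists_minHomogeneous ih (Fintype.card κ * n)
    refine ⟨N, fun α _ S χ hS => ?_⟩
    obtain ⟨U, hUS, hUc, c, hc⟩ := hN α S χ hS
    obtain ⟨i, -, hi⟩ := Finset.exists_le_card_fiber_of_mul_le_card_of_maps_to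
      (s := U) (t := Finset.univ) (f := c) (n := n) (by simp) Finset.univ_nonempty
      (by rw [hUc, Finset.card_univ])
    obtain ⟨T, hTU, hTc⟩ := Finset.exists_subset_card_eq hi
    refine ⟨T, fun x hx => hUS (Finset.mem_filter.1 (hTU hx)).1, hTc, i, fun s hs hsc => ?_⟩
    have hne : s.Nonempty := Finset.card_pos.1 (by omega)
    have hx := s.min'_mem hne
    have hmem := Finset.mem_filter.1 (hTU (hs hx))
    rw [← Finset.insert_erase hx, ← hmem.2]
    refine hc _ hmem.1 _ (fun y hy => ?_) (fun y hy => s.min'_lt_of_mem_erase_min' hne hy) ?_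
    · exact (Finset.mem_filter.1 (hTU (hs (Finset.mem_of_mem_erase hy)))).1
    · rw [Finset.card_erase_of_mem hx]; omega

/-- Two injections with the same range differ by a permutation of their domain. -/
theorem exists_perm_comp_eq {a c : Type*} {φ ψ : a → c} (hφ : Injective φ) (hψ : Injective ψ)
    (h : Set.range φ = Set.range ψ) : ∃ σ : Equiv.Perm a, φ = ψ ∘ σ := by
  refine ⟨(Equiv.ofInjective φ hφ).trans
    ((Equiv.setCongr h).trans (Equiv.ofInjective ψ hψ).symm), ?_⟩
  ext x
  simp [Equiv.apply_ofInjective_symm hψ]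

/-- dual Ramsey theorem for finite boolean algebras: for every `k ≥ 2`
and finite boolean algebras `A`, `B` with a surjective homomorphism `B → A`, there is
a finite boolean algebra `C` such that every `k`-coloring of the surjective
homomorphisms `C → A` that is invariant under composition with automorphisms of `A`
is constant, with some color `i`, on `{f ∘ w : f ∈ Surj(B, A)}` for some surjective
homomorphism `w : C → B`. -/
theorem dual_ramsey_boolean (k : ℕ) (hk : 2 ≤ k)
    (A B : Type) [BooleanAlgebra A] [Fintype A] [BooleanAlgebra B] [Fintype B]
    (hex : ∃ g : B → A, IsBoolHom g ∧ Function.Surjective g) :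
    ∃ C : BundledFinBoolAlg, ∀ χ : (C.carrier → A) → Fin k,
      (∀ α : A → A, IsBoolHom α → Function.Bijective α →
        ∀ f : C.carrier → A, IsBoolHom f → Function.Surjective f → χ (α ∘ f) = χ f) →
      ∃ (i : Fin k) (w : C.carrier → B), IsBoolHom w ∧ Function.Surjective w ∧
        ∀ f : B → A, IsBoolHom f → Function.Surjective f → χ (f ∘ w) = i := by
  classical
  have : NeZero k := ⟨by omega⟩
  obtain ⟨a, _, ⟨eA⟩⟩ := exists_orderIso_set A
  obtain ⟨b, _, ⟨eB⟩⟩ := exists_orderIso_set B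
  have := Fintype.ofFinite a
  have := Fintype.ofFinite b
  obtain ⟨N, hN⟩ := exists_monochromatic_subset (Fin k) (Fintype.card a) (Fintype.card b)
  have : Fintype (Set (Fin N)) := Fintype.ofFinite _
  refine ⟨⟨Set (Fin N)⟩, fun χ hχ => ?_⟩
  replace hχ : ∀ α : A → A, IsBoolHom α → Bijective α →
      ∀ f : Set (Fin N) → A, IsBoolHom f → Surjective f → χ (α ∘ f) = χ f := hχ
  let F : (a → Fin N) → Set (Fin N) → A := fun φ => eA.symm ∘ Set.preimage φ
  let color : Finset (Fin N) → Fin k := fun s =>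
    if h : ∃ φ : a → Fin N, Injective φ ∧ Set.range φ = s then χ (F h.choose) else 0
  obtain ⟨T, -, hTc, i, hi⟩ := hN (Fin N) Finset.univ color (by simp)
  let ψ : b ≃ T := Fintype.equivOfCardEq (by simp [hTc])
  have hψ : Injective fun x => (ψ x : Fin N) := Subtype.val_injective.comp ψ.injective
  let w : Set (Fin N) → B := eB.symm ∘ Set.preimage fun x => (ψ x : Fin N)
  have hw : IsBoolHom w := (IsBoolHom.orderIso eB.symm).comp (IsBoolHom.preimage _)
  have hws : Surjective w := eB.symm.surjective.comp hψ.preimage_surjective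
  refine ⟨i, w, hw, hws, fun f hf hfs => ?_⟩
  obtain ⟨φ, hφ, hφe⟩ := IsBoolHom.exists_injective_eq_preimage
    ((IsBoolHom.orderIso eA).comp (hf.comp hw)) (eA.surjective.comp (hfs.comp hws))
  have hfw : f ∘ w = F φ := by
    simp only [F]
    rw [← hφe]
    ext S
    simp
  have hφT : ∀ x, φ x ∈ T := by
    intro x
    by_contra hx
    have hwT : w (T : Set (Fin N))ᶜ = ⊥ := by
      have : (fun x => (ψ x : Fin N)) ⁻¹' (T : Set (Fin N))ᶜ = ⊥ := by ext y; simp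
      simp only [w, comp_apply]
      rw [this, map_bot]
    have hempty : φ ⁻¹' (T : Set (Fin N))ᶜ = ⊥ := by
      rw [← congrFun hφe]
      simp only [comp_apply]
      rw [hwT, hf.2.2.2.1, map_bot]
    have hxm : x ∈ φ ⁻¹' (T : Set (Fin N))ᶜ := by simpa using hx
    rw [hempty] at hxm
    exact hxm
  have hex' : ∃ φ' : a → Fin N, Injective φ' ∧
      Set.range φ' = (Finset.univ.image φ : Finset (Fin N)) := ⟨φ, hφ, by simp⟩
  have hcol := hi (Finset.univ.image φ) (Finset.image_subset_iff.2 fun x _ => hφT x)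
    (by rw [Finset.card_image_of_injective _ hφ, Finset.card_univ])
  simp only [color] at hcol
  rw [dif_pos hex'] at hcol
  obtain ⟨hinj, hrange⟩ := hex'.choose_spec
  obtain ⟨σ, hσ⟩ := exists_perm_comp_eq hφ hinj (by rw [hrange]; simp)
  have hF : F φ = (eA.symm ∘ Set.preimage σ ∘ eA) ∘ F hex'.choose := by
    funext S
    simp only [F, comp_apply, OrderIso.apply_symm_apply]
    rw [← Set.preimage_comp, ← hσ]
  rw [hfw, ← hcol, hF]
  refine hχ _ ?_ ?_ _ ?_ ?_
  · exact (IsBoolHom.orderIso eA.symm).comp ((IsBoolHom.preimage σ).comp (IsBoolHom.orderIso eA))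
  · exact eA.symm.bijective.comp (Bijective.comp
      ⟨σ.surjective.preimage_injective, σ.injective.preimage_surjective⟩ eA.bijective)
  · exact (IsBoolHom.orderIso eA.symm).comp (IsBoolHom.preimage _)
  · exact eA.symm.surjective.comp hinj.preimage_surjective
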